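/- The eight-fold integral $\alpha_1 = \frac{1}{2(4\pi)^4} \int_0^\infty \prod_{i=1}^4 ds_i\, s_i \int_0^\infty \prod_{i=1}^4 dt_i\, \prod_{i=1}^4 e^{-\frac{t_i}{4}(s_i^2+4s_i)} t_i^{1/2} \cdot \frac{(t_1 t_3)^2}{(\sum_{i=1}^4 t_i)^4}$ converges and equals $\frac{61}{645120\,\pi^2}$. -/

import Mathlib

open MeasureTheory Real

theorem lintegral_fin_prod_eq_prod {n : ℕ} (μ : Measure ℝ) [SigmaFinite μ]
    {f : Fin n → ℝ → ENNReal} (hf : ∀ i, Measurable (f i)) :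
    ∫⁻ x, ∏ i, f i (x i) ∂(Measure.pi fun _ : Fin n => μ) = ∏ i, ∫⁻ t, f i t ∂μ := by
  induction n with
  | zero => simp
  | succ n ih =>
    rw [← ((measurePreserving_piFinSuccAbove (fun _ => μ) 0).symm).lintegral_comp (by fun_prop)]
    simp_rw [MeasurableEquiv.piFinSuccAbove_symm_apply, Fin.insertNthEquiv, Equiv.coe_fn_mk,
      Fin.prod_univ_succ, Fin.insertNth_zero]
    simp only [Fin.cons_zero, Fin.cons_succ, cast_eq]
    rw [lintegral_prod_mul (g := fun y : Fin n → ℝ => ∏ i, f i.succ (y i))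
      (hf 0).aemeasurable (Finset.measurable_fun_prod _ fun i _ =>
        (hf i.succ).comp (measurable_pi_apply i)).aemeasurable, ih fun i => hf i.succ]

theorem lintegral_Ioi_of_hasDerivAt_of_nonneg {g g' : ℝ → ℝ} {a l : ℝ}
    (hcont : ContinuousWithinAt g (Set.Ici a) a)
    (hderiv : ∀ x ∈ Set.Ioi a, HasDerivAt g (g' x) x) (g'pos : ∀ x ∈ Set.Ioi a, 0 ≤ g' x)
    (hg : Filter.Tendsto g Filter.atTop (nhds l)) :
    ∫⁻ x in Set.Ioi a, ENNReal.ofReal (g' x) = ENNReal.ofReal (l - g a) := by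
  rw [← integral_Ioi_of_hasDerivAt_of_nonneg hcont hderiv g'pos hg,
    ofReal_integral_eq_lintegral_ofReal
      (integrableOn_Ioi_deriv_of_nonneg hcont hderiv g'pos hg)
      (ae_restrict_of_forall_mem measurableSet_Ioi g'pos)]

theorem lintegral_rpow_mul_exp_neg_mul_Ioi {q a : ℝ} (hq : 0 < q) (ha : 0 < a) :
    ∫⁻ t in Set.Ioi 0, ENNReal.ofReal (t ^ (q - 1) * exp (-(a * t))) =
      ENNReal.ofReal ((1 / a) ^ q * Gamma q) := by
  have key := integral_rpow_mul_exp_neg_mul_Ioi hq ha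
  have hpos : 0 < (1 / a) ^ q * Gamma q := by
    have := Gamma_pos_of_pos hq
    positivity
  rw [← key, ofReal_integral_eq_lintegral_ofReal
    (Integrable.of_integral_ne_zero (by rw [key]; exact hpos.ne'))]
  exact ae_restrict_of_forall_mem measurableSet_Ioi fun t (ht : 0 < t) => by
    simp only [Pi.zero_apply]; positivity

theorem hasDerivAt_sqrt_quadratic {x s : ℝ} (h : 0 < x + s + s ^ 2 / 4) :
    HasDerivAt (fun s => √(x + s + s ^ 2 / 4))
      ((s / 2 + 1) / (2 * √(x + s + s ^ 2 / 4))) s := by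
  have h1 : HasDerivAt (fun s : ℝ => x + s + s ^ 2 / 4) (s / 2 + 1) s := by
    have := ((hasDerivAt_id s).const_add x).add (((hasDerivAt_id s).pow 2).div_const 4)
    refine this.congr_deriv ?_
    simp; ring
  exact h1.sqrt h.ne'

theorem hasDerivAt_inv_sqrt_quadratic {x s : ℝ} (hx : 0 < x) (hs : 0 ≤ s) :
    HasDerivAt (fun s => (√(x + s + s ^ 2 / 4))⁻¹)
      (-((s / 2 + 1) / (2 * √(x + s + s ^ 2 / 4))) / √(x + s + s ^ 2 / 4) ^ 2) s :=
  (hasDerivAt_sqrt_quadratic (by positivity)).inv (by positivity)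

theorem hasDerivAt_inv_sqrt_quadratic_add {x s : ℝ} (hx : 0 < x) (hs : 0 ≤ s) :
    HasDerivAt (fun s => (√(x + s + s ^ 2 / 4) + (s / 2 + 1))⁻¹)
      (-(1 / (2 * √(x + s + s ^ 2 / 4))) / (√(x + s + s ^ 2 / 4) + (s / 2 + 1))) s := by
  have hu : HasDerivAt (fun s : ℝ => s / 2 + 1) (1 / 2) s :=
    ((hasDerivAt_id s).div_const 2).add_const 1
  have hR : 0 < √(x + s + s ^ 2 / 4) := by positivity
  have hv : √(x + s + s ^ 2 / 4) + (s / 2 + 1) ≠ 0 := by positivity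
  refine (((hasDerivAt_sqrt_quadratic (by positivity)).add hu).inv hv).congr_deriv ?_
  simp only [Pi.add_apply]
  field_simp
  ring

theorem tendsto_inv_sqrt_quadratic (x : ℝ) (hx : 0 < x) :
    Filter.Tendsto (fun s => (√(x + s + s ^ 2 / 4))⁻¹) Filter.atTop (nhds 0) := by
  refine (tendsto_sqrt_atTop.comp
    (Filter.tendsto_atTop_mono (fun s => ?_) Filter.tendsto_id)).inv_tendsto_atTop
  simp only [id]
  nlinarith [sq_nonneg s]

theorem tendsto_inv_sqrt_quadratic_add (x : ℝ) :
    Filter.Tendsto (fun s => (√(x + s + s ^ 2 / 4) + (s / 2 + 1))⁻¹) Filter.atTop (nhds 0) := by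
  have hu : Filter.Tendsto (fun s : ℝ => s / 2 + 1) Filter.atTop Filter.atTop :=
    Filter.tendsto_atTop_add_const_right _ _ (Filter.tendsto_id.atTop_div_const two_pos)
  refine (Filter.tendsto_atTop_mono (fun s => ?_) hu).inv_tendsto_atTop
  exact le_add_of_nonneg_left (sqrt_nonneg _)

theorem lintegral_mul_inv_sqrt_pow_three {x : ℝ} (hx : 0 < x) :
    ∫⁻ s in Set.Ioi 0, ENNReal.ofReal (s / √(x + s + s ^ 2 / 4) ^ 3) =
      ENNReal.ofReal (4 / (1 + √x)) := by
  have hd : ∀ s : ℝ, 0 ≤ s → HasDerivAt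
      (fun s => 4 * ((√(x + s + s ^ 2 / 4))⁻¹ * (√(x + s + s ^ 2 / 4) + (s / 2 + 1))⁻¹ -
        (√(x + s + s ^ 2 / 4))⁻¹))
      (s / √(x + s + s ^ 2 / 4) ^ 3) s := by
    intro s hs
    have hR : 0 < √(x + s + s ^ 2 / 4) := by positivity
    have ha := hasDerivAt_inv_sqrt_quadratic hx hs
    have hw := hasDerivAt_inv_sqrt_quadratic_add hx hs
    refine (((ha.mul hw).sub ha).const_mul 4).congr_deriv ?_
    clear ha hw
    generalize √(x + s + s ^ 2 / 4) = R at *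
    have hv : R + (s / 2 + 1) ≠ 0 := by positivity
    field_simp
    ring
  rw [lintegral_Ioi_of_hasDerivAt_of_nonneg (l := 0)
    (hd 0 le_rfl).continuousAt.continuousWithinAt
    (fun s hs => hd s (Set.mem_Ioi.1 hs).le) (fun s (hs : 0 < s) => by positivity)]
  · congr 1
    have := sqrt_pos.2 hx
    simp
    field_simp
    ring
  · have ha := tendsto_inv_sqrt_quadratic x hx
    have hw := tendsto_inv_sqrt_quadratic_add x
    simpa using ((ha.mul hw).sub ha).const_mul 4

theorem lintegral_mul_inv_sqrt_pow_seven {x : ℝ} (hx : 0 < x) :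
    ∫⁻ s in Set.Ioi 0, ENNReal.ofReal (s / √(x + s + s ^ 2 / 4) ^ 7) =
      ENNReal.ofReal (4 / 15 * (1 + 3 * √x) / (√x ^ 3 * (1 + √x) ^ 3)) := by
  let a : ℝ → ℝ := fun s => (√(x + s + s ^ 2 / 4))⁻¹
  let w : ℝ → ℝ := fun s => (√(x + s + s ^ 2 / 4) + (s / 2 + 1))⁻¹
  have hd : ∀ s : ℝ, 0 ≤ s → HasDerivAt
      (fun s => 4 / 15 * (2 * (a s ^ 3 * w s ^ 3) + 3 * (a s ^ 4 * w s ^ 2) +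
        3 * (a s ^ 5 * w s) - 3 * a s ^ 5))
      (s / √(x + s + s ^ 2 / 4) ^ 7) s := by
    intro s hs
    have hR : 0 < √(x + s + s ^ 2 / 4) := by positivity
    have ha : HasDerivAt a _ s := hasDerivAt_inv_sqrt_quadratic hx hs
    have hw : HasDerivAt w _ s := hasDerivAt_inv_sqrt_quadratic_add hx hs
    refine ((((((ha.pow 3).mul (hw.pow 3)).const_mul 2).add
      (((ha.pow 4).mul (hw.pow 2)).const_mul 3)).add (((ha.pow 5).mul hw).const_mul 3)).sub
      ((ha.pow 5).const_mul 3)).const_mul (4 / 15) |>.congr_deriv ?_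
    clear ha hw
    simp only [Pi.pow_apply, Nat.cast_ofNat, Nat.reduceSub, a, w]
    generalize √(x + s + s ^ 2 / 4) = R at *
    have hv : R + (s / 2 + 1) ≠ 0 := by positivity
    field_simp
    ring
  rw [lintegral_Ioi_of_hasDerivAt_of_nonneg (l := 0)
    (hd 0 le_rfl).continuousAt.continuousWithinAt
    (fun s hs => hd s (Set.mem_Ioi.1 hs).le) (fun s (hs : 0 < s) => by positivity)]
  · congr 1
    have := sqrt_pos.2 hx
    simp [a, w]
    field_simp
    ring
  · have ha : Filter.Tendsto a Filter.atTop (nhds 0) := tendsto_inv_sqrt_quadratic x hx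
    have hw : Filter.Tendsto w Filter.atTop (nhds 0) := tendsto_inv_sqrt_quadratic_add x
    simpa using ((((((ha.pow 3).mul (hw.pow 3)).const_mul 2).add
      (((ha.pow 4).mul (hw.pow 2)).const_mul 3)).add (((ha.pow 5).mul hw).const_mul 3)).sub
      ((ha.pow 5).const_mul 3)).const_mul (4 / 15)

theorem lintegral_Ioi_sq_div_one_add_sqrt_pow_eight :
    ∫⁻ x in Set.Ioi 0, ENNReal.ofReal (π ^ 2 / 6 * ((1 + 3 * √x) ^ 2 / (1 + √x) ^ 8)) =
      ENNReal.ofReal (61 * π ^ 2 / 1260) := by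
  let g : ℝ → ℝ := fun x => π ^ 2 / 6 * (-(9 / 2) * ((1 + √x)⁻¹) ^ 4 + 42 / 5 * ((1 + √x)⁻¹) ^ 5
    - 16 / 3 * ((1 + √x)⁻¹) ^ 6 + 8 / 7 * ((1 + √x)⁻¹) ^ 7)
  rw [lintegral_Ioi_of_hasDerivAt_of_nonneg (g := g) (l := 0)]
  · simp [g]; congr 1; ring
  · refine Continuous.continuousWithinAt ?_
    have : ∀ x : ℝ, 1 + √x ≠ 0 := fun x => by positivity
    fun_prop (disch := exact this _)
  · intro x (hx : 0 < x)
    have hy := sqrt_pos.2 hx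
    have hv : HasDerivAt (fun x => (1 + √x)⁻¹) (-(1 / (2 * √x)) / (1 + √x) ^ 2) x :=
      ((hasDerivAt_sqrt hx.ne').const_add 1).inv (by positivity)
    have := (((((hv.pow 4).const_mul (-(9 / 2))).add ((hv.pow 5).const_mul (42 / 5))).sub
      ((hv.pow 6).const_mul (16 / 3))).add ((hv.pow 7).const_mul (8 / 7))).const_mul (π ^ 2 / 6)
    refine this.congr_deriv ?_
    clear this hv
    generalize √x = y at *
    have hv : 1 + y ≠ 0 := by positivity
    simp only [Nat.cast_ofNat, Nat.reduceSub]
    field_simp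
    ring
  · intro x _; positivity
  · have hv : Filter.Tendsto (fun x => (1 + √x)⁻¹) Filter.atTop (nhds 0) :=
      (Filter.tendsto_atTop_add_const_left _ 1 tendsto_sqrt_atTop).inv_tendsto_atTop
    have := (((((hv.pow 4).const_mul (-(9 / 2))).add ((hv.pow 5).const_mul (42 / 5))).sub
      ((hv.pow 6).const_mul (16 / 3))).add ((hv.pow 7).const_mul (8 / 7))).const_mul (π ^ 2 / 6)
    simpa [g] using this

/-- The integrand attached to one propagator of the loop, weighted by `t ^ p * exp (-x t)`. -/
noncomputable def propagatorKernel (p : ℕ) (x s t : ℝ) : ℝ :=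
  s * (exp (-(t / 4) * (s ^ 2 + 4 * s)) * t ^ ((1 : ℝ) / 2)) * (t ^ p * exp (-(x * t)))

theorem propagatorKernel_nonneg {p : ℕ} {x s t : ℝ} (hs : 0 < s) (ht : 0 < t) :
    0 ≤ propagatorKernel p x s t := by
  unfold propagatorKernel
  positivity

theorem lintegral_propagatorKernel (p : ℕ) {x s : ℝ} (hx : 0 < x) (hs : 0 < s) :
    ∫⁻ t in Set.Ioi 0, ENNReal.ofReal (propagatorKernel p x s t) =
      ENNReal.ofReal (Gamma (p + 3 / 2)) *
        ENNReal.ofReal (s / √(x + s + s ^ 2 / 4) ^ (2 * p + 3)) := by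
  have ha : 0 < x + s + s ^ 2 / 4 := by positivity
  have hG : 0 < Gamma (p + 3 / 2) := Gamma_pos_of_pos (by positivity)
  calc
    _ = ∫⁻ t in Set.Ioi 0, ENNReal.ofReal s *
          ENNReal.ofReal (t ^ ((p + 3 / 2 : ℝ) - 1) * exp (-((x + s + s ^ 2 / 4) * t))) := by
      refine setLIntegral_congr_fun measurableSet_Ioi fun t (ht : 0 < t) => ?_
      rw [← ENNReal.ofReal_mul hs.le, propagatorKernel,
        show (p + 3 / 2 : ℝ) - 1 = 1 / 2 + p by ring, rpow_add ht, rpow_natCast,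
        show -((x + s + s ^ 2 / 4) * t) = -(t / 4) * (s ^ 2 + 4 * s) + -(x * t) by ring, exp_add]
      congr 1
      ring
    _ = _ := by
      rw [lintegral_const_mul _ (by fun_prop),
        lintegral_rpow_mul_exp_neg_mul_Ioi (by positivity) ha, ← ENNReal.ofReal_mul hs.le,
        ← ENNReal.ofReal_mul hG.le]
      congr 1
      have hpow : √(x + s + s ^ 2 / 4) ^ (2 * p + 3) = (x + s + s ^ 2 / 4) ^ (p + 3 / 2 : ℝ) := by
        rw [sqrt_eq_rpow, ← rpow_natCast, ← rpow_mul ha.le]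
        push_cast
        ring_nf
      rw [hpow, one_div, inv_rpow ha.le]
      ring

theorem Gamma_three_halves : Gamma (3 / 2) = √π / 2 := by
  rw [show (3 / 2 : ℝ) = 1 / 2 + 1 by norm_num, Gamma_add_one (by norm_num), Gamma_one_half_eq]
  ring

theorem Gamma_seven_halves : Gamma (7 / 2) = 15 * √π / 8 := by
  rw [show (7 / 2 : ℝ) = 3 / 2 + 1 + 1 by norm_num, Gamma_add_one (by norm_num),
    Gamma_add_one (by norm_num), Gamma_three_halves]
  ring

theorem lintegral_lintegral_propagatorKernel_zero {x : ℝ} (hx : 0 < x) :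
    ∫⁻ s in Set.Ioi 0, ∫⁻ t in Set.Ioi 0, ENNReal.ofReal (propagatorKernel 0 x s t) =
      ENNReal.ofReal (2 * √π / (1 + √x)) := by
  rw [setLIntegral_congr_fun measurableSet_Ioi fun s hs =>
    lintegral_propagatorKernel 0 hx hs, lintegral_const_mul _ (by fun_prop),
    lintegral_mul_inv_sqrt_pow_three hx, ← ENNReal.ofReal_mul (Gamma_nonneg_of_nonneg (by positivity))]
  congr 1
  rw [Nat.cast_zero, zero_add, Gamma_three_halves]
  ring

theorem lintegral_lintegral_propagatorKernel_two {x : ℝ} (hx : 0 < x) :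
    ∫⁻ s in Set.Ioi 0, ∫⁻ t in Set.Ioi 0, ENNReal.ofReal (propagatorKernel 2 x s t) =
      ENNReal.ofReal (√π / 2 * (1 + 3 * √x) / (√x ^ 3 * (1 + √x) ^ 3)) := by
  rw [setLIntegral_congr_fun measurableSet_Ioi fun s hs =>
    lintegral_propagatorKernel 2 hx hs, lintegral_const_mul _ (by fun_prop),
    lintegral_mul_inv_sqrt_pow_seven hx,
    ← ENNReal.ofReal_mul (Gamma_nonneg_of_nonneg (by positivity))]
  congr 1
  rw [show ((2 : ℕ) + 3 / 2 : ℝ) = 7 / 2 by norm_num, Gamma_seven_halves]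
  ring

/-- The integrand of `α₁`. -/
noncomputable def boxIntegrand (st : (Fin 4 → ℝ) × (Fin 4 → ℝ)) : ℝ :=
  (∏ i, st.1 i) *
    (∏ i, exp (-(st.2 i / 4) * ((st.1 i) ^ 2 + 4 * st.1 i)) * (st.2 i) ^ ((1 : ℝ) / 2)) *
    ((st.2 0 * st.2 2) ^ 2 / (∑ i, st.2 i) ^ 4)

theorem ofReal_boxIntegrand {s t : Fin 4 → ℝ} (hs : ∀ i, 0 < s i) (ht : ∀ i, 0 < t i) :
    ENNReal.ofReal (boxIntegrand (s, t)) =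
      ∫⁻ x in Set.Ioi 0, ENNReal.ofReal (x ^ 3 / 6) *
        ∏ i, ENNReal.ofReal (propagatorKernel (![2, 0, 2, 0] i) x (s i) (t i)) := by
  have hT : 0 < ∑ i, t i := Finset.sum_pos (fun i _ => ht i) Finset.univ_nonempty
  set C : ℝ := (∏ i, s i) *
    (∏ i, exp (-(t i / 4) * ((s i) ^ 2 + 4 * s i)) * (t i) ^ ((1 : ℝ) / 2)) *
    (t 0 * t 2) ^ 2 with hC
  have hC0 : 0 ≤ C := by
    have h1 := fun i => (hs i).le
    have h2 := fun i => (ht i).le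
    have := Finset.prod_nonneg fun i (_ : i ∈ Finset.univ) => h1 i
    have := Finset.prod_nonneg fun i (_ : i ∈ Finset.univ) =>
      mul_nonneg (exp_nonneg (-(t i / 4) * ((s i) ^ 2 + 4 * s i))) (rpow_nonneg (h2 i) (1 / 2))
    positivity
  symm
  calc
    _ = ∫⁻ x in Set.Ioi 0, ENNReal.ofReal (C / 6) *
          ENNReal.ofReal (x ^ ((4 : ℝ) - 1) * exp (-((∑ i, t i) * x))) := by
      refine setLIntegral_congr_fun measurableSet_Ioi fun x (hx : 0 < x) => ?_
      rw [← ENNReal.ofReal_prod_of_nonneg fun i _ => propagatorKernel_nonneg (hs i) (ht i),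
        ← ENNReal.ofReal_mul (by positivity), ← ENNReal.ofReal_mul (by positivity),
        show (4 : ℝ) - 1 = (3 : ℕ) by norm_num, rpow_natCast]
      congr 1
      simp only [propagatorKernel, Finset.prod_mul_distrib, ← exp_sum, hC, Finset.sum_neg_distrib,
        ← Finset.sum_mul, mul_comm x]
      simp only [Fin.prod_univ_four, Matrix.cons_val]
      ring
    _ = _ := by
      rw [lintegral_const_mul _ (by fun_prop),
        lintegral_rpow_mul_exp_neg_mul_Ioi (by norm_num) hT,
        ← ENNReal.ofReal_mul (by positivity), boxIntegrand]
      congr 1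
      have hG : Gamma 4 = 6 := by
        rw [show (4 : ℝ) = (3 : ℕ) + 1 by norm_num, Gamma_nat_eq_factorial]
        norm_num [Nat.factorial]
      rw [hG, rpow_ofNat, ← mul_div_assoc, ← hC]
      ring

theorem volume_restrict_pos_prod (n : ℕ) :
    (volume : Measure ((Fin n → ℝ) × (Fin n → ℝ))).restrict
        ({s : Fin n → ℝ | ∀ i, 0 < s i} ×ˢ {t : Fin n → ℝ | ∀ i, 0 < t i}) =
      (Measure.pi fun _ => volume.restrict (Set.Ioi 0)).prod
        (Measure.pi fun _ => volume.restrict (Set.Ioi 0)) := by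
  have h : {s : Fin n → ℝ | ∀ i, 0 < s i} = Set.univ.pi fun _ => Set.Ioi 0 := by
    ext; simp
  rw [h, Measure.volume_eq_prod, ← Measure.prod_restrict, volume_pi, Measure.restrict_pi_pi]

theorem lintegral_prod_fin_eq_prod {n : ℕ} (μ : Measure ℝ) [SigmaFinite μ]
    {f : Fin n → ℝ → ℝ → ENNReal} (hf : ∀ i, Measurable (Function.uncurry (f i))) :
    ∫⁻ st : (Fin n → ℝ) × (Fin n → ℝ), ∏ i, f i (st.1 i) (st.2 i)
        ∂(Measure.pi fun _ => μ).prod (Measure.pi fun _ => μ) =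
      ∏ i, ∫⁻ s, ∫⁻ t, f i s t ∂μ ∂μ := by
  have hm : Measurable fun st : (Fin n → ℝ) × (Fin n → ℝ) => ∏ i, f i (st.1 i) (st.2 i) := by
    refine Finset.measurable_fun_prod _ fun i _ => ?_
    have h : Measurable fun st : (Fin n → ℝ) × (Fin n → ℝ) => (st.1 i, st.2 i) := by fun_prop
    exact (hf i).comp h
  rw [lintegral_prod _ hm.aemeasurable,
    ← lintegral_fin_prod_eq_prod μ fun i => (hf i).lintegral_prod_right]
  refine lintegral_congr fun s => ?_
  exact lintegral_fin_prod_eq_prod μ fun i => (hf i).of_uncurry_left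

theorem measurable_propagatorKernel (p : ℕ) :
    Measurable fun z : ℝ × ℝ × ℝ => propagatorKernel p z.1 z.2.1 z.2.2 := by
  unfold propagatorKernel
  fun_prop

theorem lintegral_boxIntegrand :
    ∫⁻ st in ({s : Fin 4 → ℝ | ∀ i, 0 < s i} ×ˢ {t : Fin 4 → ℝ | ∀ i, 0 < t i}),
      ENNReal.ofReal (boxIntegrand st) = ENNReal.ofReal (61 * π ^ 2 / 1260) := by
  have hS : MeasurableSet {s : Fin 4 → ℝ | ∀ i, 0 < s i} := by measurability
  have hK (i : Fin 4) : Measurable fun z : ℝ × ℝ × ℝ =>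
      ENNReal.ofReal (propagatorKernel (![2, 0, 2, 0] i) z.1 z.2.1 z.2.2) :=
    (measurable_propagatorKernel _).ennreal_ofReal
  rw [setLIntegral_congr_fun (hS.prod hS) fun st hst => ofReal_boxIntegrand hst.1 hst.2,
    volume_restrict_pos_prod, lintegral_lintegral_swap, ← lintegral_Ioi_sq_div_one_add_sqrt_pow_eight]
  · refine setLIntegral_congr_fun measurableSet_Ioi fun x (hx : 0 < x) => ?_
    have hKx (i : Fin 4) : Measurable (Function.uncurry fun s t : ℝ =>
        ENNReal.ofReal (propagatorKernel (![2, 0, 2, 0] i) x s t)) :=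
      (hK i).comp (measurable_const.prodMk measurable_id)
    rw [lintegral_const_mul' _ _ ENNReal.ofReal_ne_top, lintegral_prod_fin_eq_prod _ hKx]
    simp only [Fin.prod_univ_four, Matrix.cons_val, lintegral_lintegral_propagatorKernel_zero hx,
      lintegral_lintegral_propagatorKernel_two hx]
    have hy := sqrt_pos.2 hx
    have hxy : x = √x ^ 2 := (sq_sqrt hx.le).symm
    have hp : π = √π ^ 2 := (sq_sqrt pi_pos.le).symm
    rw [← ENNReal.ofReal_mul (by positivity), ← ENNReal.ofReal_mul (by positivity),
      ← ENNReal.ofReal_mul (by positivity), ← ENNReal.ofReal_mul (by positivity)]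
    congr 1
    have h3 : x ^ 3 = √x ^ 6 := by rw [hxy]; simp [← pow_mul]
    have h2 : π ^ 2 = √π ^ 4 := by rw [hp]; simp [← pow_mul]
    rw [h3, h2]
    field_simp
  · refine Measurable.aemeasurable ?_
    refine Measurable.mul (f := fun z : ((Fin 4 → ℝ) × (Fin 4 → ℝ)) × ℝ =>
      ENNReal.ofReal (z.2 ^ 3 / 6)) (by fun_prop) (Finset.measurable_fun_prod _ fun i _ => ?_)
    have h : Measurable fun z : ((Fin 4 → ℝ) × (Fin 4 → ℝ)) × ℝ =>
      (z.2, z.1.1 i, z.1.2 i) := by fun_prop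
    exact (hK i).comp h

theorem measurable_boxIntegrand : Measurable boxIntegrand := by
  unfold boxIntegrand
  fun_prop

theorem boxIntegrand_nonneg_ae :
    0 ≤ᵐ[volume.restrict ({s : Fin 4 → ℝ | ∀ i, 0 < s i} ×ˢ {t : Fin 4 → ℝ | ∀ i, 0 < t i})]
      boxIntegrand := by
  have hS : MeasurableSet {s : Fin 4 → ℝ | ∀ i, 0 < s i} := by measurability
  refine ae_restrict_of_forall_mem (hS.prod hS) fun st hst => ?_
  have hs : ∀ i, 0 ≤ st.1 i := fun i => (hst.1 i).le
  have ht : ∀ i, 0 ≤ st.2 i := fun i => (hst.2 i).le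
  exact mul_nonneg (mul_nonneg (Finset.prod_nonneg fun i _ => hs i)
    (Finset.prod_nonneg fun i _ => mul_nonneg (exp_nonneg _) (rpow_nonneg (ht i) _)))
    (by positivity)

/-- The eight-fold Schwinger-parameter integral `α₁` converges and equals
`61/(645120 π²)`. -/
theorem alpha_one_value :
    MeasureTheory.IntegrableOn
        (fun st : (Fin 4 → ℝ) × (Fin 4 → ℝ) =>
          (∏ i, st.1 i) *
            (∏ i, Real.exp (-(st.2 i / 4) * ((st.1 i) ^ 2 + 4 * st.1 i)) *
              (st.2 i) ^ ((1 : ℝ) / 2)) *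
            ((st.2 0 * st.2 2) ^ 2 / (∑ i, st.2 i) ^ 4))
        ({s : Fin 4 → ℝ | ∀ i, 0 < s i} ×ˢ {t : Fin 4 → ℝ | ∀ i, 0 < t i}) ∧
      (1 / (2 * (4 * π) ^ 4)) *
          ∫ st in ({s : Fin 4 → ℝ | ∀ i, 0 < s i} ×ˢ {t : Fin 4 → ℝ | ∀ i, 0 < t i}),
            (∏ i, st.1 i) *
              (∏ i, Real.exp (-(st.2 i / 4) * ((st.1 i) ^ 2 + 4 * st.1 i)) *
                (st.2 i) ^ ((1 : ℝ) / 2)) *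
              ((st.2 0 * st.2 2) ^ 2 / (∑ i, st.2 i) ^ 4)
        = 61 / (645120 * π ^ 2) := by
  constructor
  · change IntegrableOn boxIntegrand _ volume
    rw [IntegrableOn, ← lintegral_ofReal_ne_top_iff_integrable
      measurable_boxIntegrand.aestronglyMeasurable boxIntegrand_nonneg_ae, lintegral_boxIntegrand]
    exact ENNReal.ofReal_ne_top
  · change _ * (∫ st in _, boxIntegrand st) = _
    rw [integral_eq_lintegral_of_nonneg_ae boxIntegrand_nonneg_ae
      measurable_boxIntegrand.aestronglyMeasurable, lintegral_boxIntegrand,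
      ENNReal.toReal_ofReal (by positivity)]
    field_simp
    norm_num
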